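/- Let s > 3/2 and s−1 ≤ s' ≤ s+1. There exists a constant C > 0, depending only on s and s', such that for all Schwartz vector fields u, B : ℝ³ → ℝ³ one has ∥u × B∥_{H^{s−1}} ≤ C ∥u∥_{H^{s'}} ∥B∥_{H^s}, where × is the pointwise cross product on ℝ³. -/

import Mathlib

open MeasureTheory SchwartzMap Real
open scoped FourierTransform

noncomputable section

/-- `ℝ³` as a Euclidean space. -/
abbrev E3 : Type := EuclideanSpace ℝ (Fin 3)

/-- The (squared-integral based) Sobolev `H^σ` norm of a complex-valued function on `ℝ³`,
defined via the Fourier transform. -/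
noncomputable def HNorm (σ : ℝ) (f : E3 → ℂ) : ℝ :=
  (∫ ξ : E3, (1 + ‖ξ‖ ^ 2) ^ σ * ‖𝓕 f ξ‖ ^ 2) ^ ((1 : ℝ) / 2)

/-- The Sobolev `H^σ` norm of a real-valued function. -/
noncomputable def HNormR (σ : ℝ) (f : E3 → ℝ) : ℝ :=
  HNorm σ (fun x => (f x : ℂ))

/-- The `j`-th partial derivative of a real-valued function on `ℝ³`. -/
noncomputable def pdR (j : Fin 3) (f : E3 → ℝ) : E3 → ℝ :=
  fun x => fderiv ℝ f x (EuclideanSpace.single j 1)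

/-- The `j`-th partial derivative of a complex-valued function on `ℝ³`. -/
noncomputable def pdC (j : Fin 3) (f : E3 → ℂ) : E3 → ℂ :=
  fun x => fderiv ℝ f x (EuclideanSpace.single j 1)

/-- The Sobolev `H^σ` norm of a vector field `u : ℝ³ → ℝ³`:
`∥u∥_{H^σ}² = Σ_i ∥u_i∥_{H^σ}²`. -/
noncomputable def VNorm (σ : ℝ) (u : Fin 3 → E3 → ℝ) : ℝ :=
  (∑ i : Fin 3, (HNormR σ (u i)) ^ 2) ^ ((1 : ℝ) / 2)

/-- `∥∇u∥_{H^σ}² = Σ_{i,j} ∥∂_j u_i∥_{H^σ}²` for a vector field `u : ℝ³ → ℝ³`. -/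
noncomputable def GradVNorm (σ : ℝ) (u : Fin 3 → E3 → ℝ) : ℝ :=
  (∑ i : Fin 3, ∑ j : Fin 3, (HNormR σ (pdR j (u i))) ^ 2) ^ ((1 : ℝ) / 2)

/-- The advection term `(u·∇)v`, with components `Σ_j u_j ∂_j v_i`. -/
noncomputable def adv (u v : Fin 3 → E3 → ℝ) : Fin 3 → E3 → ℝ :=
  fun i x => ∑ j : Fin 3, u j x * pdR j (v i) x

/-- The pointwise cross product of two vector fields on `ℝ³`. -/
noncomputable def crossVF (u v : Fin 3 → E3 → ℝ) : Fin 3 → E3 → ℝ :=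
  fun i x =>
    ![u 1 x * v 2 x - u 2 x * v 1 x,
      u 2 x * v 0 x - u 0 x * v 2 x,
      u 0 x * v 1 x - u 1 x * v 0 x] i

/-- A Schwartz vector field, viewed as a plain vector field. -/
noncomputable def toVF (u : Fin 3 → SchwartzMap E3 ℝ) : Fin 3 → E3 → ℝ :=
  fun i => ⇑(u i)

/-- The extended nonnegative weight `(1 + ‖x‖²)^σ`. -/
def sobolevWeight (σ : ℝ) (x : E3) : ENNReal :=
  ENNReal.ofReal ((1 + ‖x‖ ^ 2) ^ σ)

lemma measurable_sobolevWeight (σ : ℝ) : Measurable (sobolevWeight σ) := by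
  unfold sobolevWeight
  fun_prop

lemma sobolevWeight_add (σ τ : ℝ) (x : E3) :
    sobolevWeight (σ + τ) x = sobolevWeight σ x * sobolevWeight τ x := by
  unfold sobolevWeight
  rw [Real.rpow_add (by positivity), ENNReal.ofReal_mul (by positivity)]

lemma sobolevWeight_half_sq (σ : ℝ) (x : E3) :
    sobolevWeight (σ / 2) x ^ 2 = sobolevWeight σ x := by
  rw [sq, ← sobolevWeight_add, add_halves]

lemma sobolevWeight_half_neg_mul (σ : ℝ) (x : E3) :
    sobolevWeight (-σ / 2) x * sobolevWeight (σ / 2) x = 1 := by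
  rw [← sobolevWeight_add, neg_div, neg_add_cancel]
  simp [sobolevWeight]

lemma lintegral_sobolevWeight_neg_lt_top {s : ℝ} (hs : 3 / 2 < s) :
    ∫⁻ x, sobolevWeight (-s) x < ⊤ := by
  have h := integrable_rpow_neg_one_add_norm_sq (E := E3) (μ := volume) (r := 2 * s)
    (by simp; linarith)
  have e : -(2 * s) / 2 = -s := by ring
  rw [e] at h
  exact h.lintegral_lt_top

lemma rpow_mul_rpow_mul_rpow_le {s a b c : ℝ} (hs : 1 ≤ s) (ha : 0 < a) (hb : 0 < b)
    (hc : 0 < c) (habc : c ≤ 2 * (a + b)) :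
    c ^ (s - 1) * a ^ (-(s - 1)) * b ^ (-s) ≤ 4 ^ (s - 1) * (a ^ (-s) + b ^ (-s)) := by
  have h0 : 0 ≤ s - 1 := by linarith
  rcases le_total b a with hab | hab
  · have h1 : c ^ (s - 1) ≤ 4 ^ (s - 1) * a ^ (s - 1) := by
      rw [← Real.mul_rpow (by norm_num) ha.le]
      exact Real.rpow_le_rpow hc.le (by linarith) h0
    calc c ^ (s - 1) * a ^ (-(s - 1)) * b ^ (-s)
        ≤ (4 ^ (s - 1) * a ^ (s - 1)) * a ^ (-(s - 1)) * b ^ (-s) := by gcongr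
      _ = 4 ^ (s - 1) * b ^ (-s) := by
          rw [mul_assoc (4 ^ (s - 1)), ← Real.rpow_add ha]; simp
      _ ≤ 4 ^ (s - 1) * (a ^ (-s) + b ^ (-s)) := by
          gcongr
          linarith [Real.rpow_pos_of_pos ha (-s)]
  · have h1 : c ^ (s - 1) ≤ 4 ^ (s - 1) * b ^ (s - 1) := by
      rw [← Real.mul_rpow (by norm_num) hb.le]
      exact Real.rpow_le_rpow hc.le (by linarith) h0
    calc c ^ (s - 1) * a ^ (-(s - 1)) * b ^ (-s)
        ≤ (4 ^ (s - 1) * b ^ (s - 1)) * a ^ (-(s - 1)) * b ^ (-s) := by gcongr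
      _ = 4 ^ (s - 1) * (a ^ (-(s - 1)) * (b ^ (s - 1) * b ^ (-s))) := by ring
      _ = 4 ^ (s - 1) * (a ^ (-(s - 1)) * b ^ (-1 : ℝ)) := by
          rw [← Real.rpow_add hb]; ring_nf
      _ ≤ 4 ^ (s - 1) * (a ^ (-(s - 1)) * a ^ (-1 : ℝ)) := by
          gcongr 4 ^ (s - 1) * (a ^ (-(s - 1)) * ?_)
          exact Real.rpow_le_rpow_of_nonpos ha hab (by norm_num)
      _ = 4 ^ (s - 1) * a ^ (-s) := by
          rw [← Real.rpow_add ha]; ring_nf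
      _ ≤ 4 ^ (s - 1) * (a ^ (-s) + b ^ (-s)) := by
          gcongr
          linarith [Real.rpow_pos_of_pos hb (-s)]

lemma sobolevWeight_kernel_le {s : ℝ} (hs : 1 ≤ s) (x y : E3) :
    sobolevWeight (s - 1) x * sobolevWeight (-(s - 1)) y * sobolevWeight (-s) (x - y) ≤
      ENNReal.ofReal (4 ^ (s - 1)) * (sobolevWeight (-s) y + sobolevWeight (-s) (x - y)) := by
  unfold sobolevWeight
  rw [← ENNReal.ofReal_mul (by positivity), ← ENNReal.ofReal_mul (by positivity),
    ← ENNReal.ofReal_add (by positivity) (by positivity), ← ENNReal.ofReal_mul (by positivity)]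
  refine ENNReal.ofReal_le_ofReal (rpow_mul_rpow_mul_rpow_le hs (by positivity) (by positivity)
    (by positivity) ?_)
  have h : ‖x‖ ≤ ‖y‖ + ‖x - y‖ := by simpa using norm_add_le y (x - y)
  nlinarith [norm_nonneg x, norm_nonneg y, norm_nonneg (x - y), sq_nonneg (‖y‖ - ‖x - y‖)]

/-- The uniform bound for the integral of the kernel governing the product estimate. -/
def kernelBound (s : ℝ) : ENNReal :=
  ENNReal.ofReal (4 ^ (s - 1)) * (2 * ∫⁻ y, sobolevWeight (-s) y)

lemma kernelBound_lt_top {s : ℝ} (hs : 3 / 2 < s) : kernelBound s < ⊤ :=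
  ENNReal.mul_lt_top ENNReal.ofReal_lt_top
    (ENNReal.mul_lt_top (by simp) (lintegral_sobolevWeight_neg_lt_top hs))

lemma lintegral_kernel_le {s : ℝ} (hs : 1 ≤ s) (x : E3) :
    ∫⁻ y, sobolevWeight (s - 1) x * sobolevWeight (-(s - 1)) y * sobolevWeight (-s) (x - y) ≤
      kernelBound s := by
  refine (lintegral_mono fun y => sobolevWeight_kernel_le hs x y).trans ?_
  rw [lintegral_const_mul' _ _ ENNReal.ofReal_ne_top,
    lintegral_add_left (measurable_sobolevWeight _),
    lintegral_sub_left_eq_self (fun z => sobolevWeight (-s) z) x, ← two_mul, kernelBound]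

lemma lintegral_mul_sq_le {α : Type*} [MeasurableSpace α] {μ : Measure α} {f g : α → ENNReal}
    (hf : Measurable f) (hg : Measurable g) :
    (∫⁻ a, f a * g a ∂μ) ^ 2 ≤ (∫⁻ a, f a ^ 2 ∂μ) * ∫⁻ a, g a ^ 2 ∂μ := by
  have h := ENNReal.lintegral_mul_le_Lp_mul_Lq μ Real.HolderConjugate.two_two
    hf.aemeasurable hg.aemeasurable
  have h2 := pow_le_pow_left' h 2
  rw [mul_pow] at h2
  have e (t : ENNReal) : (t ^ (1 / 2 : ℝ)) ^ 2 = t := by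
    rw [← ENNReal.rpow_natCast, ← ENNReal.rpow_mul]
    norm_num
  simpa only [e, ENNReal.rpow_two, Pi.mul_apply] using h2

lemma lintegral_lintegral_mul_sub {a b : E3 → ENNReal} (ha : Measurable a) (hb : Measurable b) :
    ∫⁻ x, ∫⁻ y, a y * b (x - y) = (∫⁻ y, a y) * ∫⁻ z, b z := by
  rw [lintegral_lintegral_swap (by fun_prop)]
  have h (y : E3) : ∫⁻ x, a y * b (x - y) = a y * ∫⁻ z, b z := by
    rw [lintegral_const_mul _ (by fun_prop), lintegral_sub_right_eq_self b y]
  simp_rw [h]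
  rw [lintegral_mul_const _ ha]

/-- The weighted `L²` estimate for convolutions behind the Sobolev product estimate. -/
lemma lintegral_sobolevWeight_mul_convolution_sq_le {s : ℝ} (hs : 3 / 2 < s) {f g : E3 → ENNReal}
    (hf : Measurable f) (hg : Measurable g) :
    ∫⁻ x, sobolevWeight (s - 1) x * (∫⁻ y, f y * g (x - y)) ^ 2 ≤
      kernelBound s * ((∫⁻ y, sobolevWeight (s - 1) y * f y ^ 2) *
        ∫⁻ z, sobolevWeight s z * g z ^ 2) := by
  have hw := measurable_sobolevWeight
  have key (x : E3) : sobolevWeight (s - 1) x * (∫⁻ y, f y * g (x - y)) ^ 2 ≤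
      kernelBound s * ∫⁻ y, (sobolevWeight (s - 1) y * f y ^ 2) *
        (sobolevWeight s (x - y) * g (x - y) ^ 2) := by
    have hwx (σ : ℝ) : Measurable fun y => sobolevWeight σ (x - y) :=
      (hw σ).comp (measurable_const.sub measurable_id)
    have hgx : Measurable fun y => g (x - y) := hg.comp (measurable_const.sub measurable_id)
    let k : E3 → ENNReal := fun y => sobolevWeight ((s - 1) / 2) x *
      sobolevWeight (-(s - 1) / 2) y * sobolevWeight (-s / 2) (x - y)
    let q : E3 → ENNReal := fun y => (sobolevWeight ((s - 1) / 2) y * f y) *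
      (sobolevWeight (s / 2) (x - y) * g (x - y))
    have hk : Measurable k := (measurable_const.mul (hw _)).mul (hwx _)
    have hq : Measurable q := ((hw _).mul hf).mul ((hwx _).mul hgx)
    have hkq (y : E3) : k y * q y = sobolevWeight ((s - 1) / 2) x * (f y * g (x - y)) := by
      calc k y * q y = sobolevWeight ((s - 1) / 2) x *
            (sobolevWeight (-(s - 1) / 2) y * sobolevWeight ((s - 1) / 2) y) *
            (sobolevWeight (-s / 2) (x - y) * sobolevWeight (s / 2) (x - y)) *
            (f y * g (x - y)) := by simp only [k, q]; ring
        _ = _ := by rw [sobolevWeight_half_neg_mul, sobolevWeight_half_neg_mul, mul_one, mul_one]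
    calc sobolevWeight (s - 1) x * (∫⁻ y, f y * g (x - y)) ^ 2
        = (∫⁻ y, k y * q y) ^ 2 := by
          simp_rw [hkq]
          rw [lintegral_const_mul _ (by fun_prop), mul_pow, sobolevWeight_half_sq]
      _ ≤ (∫⁻ y, k y ^ 2) * ∫⁻ y, q y ^ 2 := lintegral_mul_sq_le hk hq
      _ ≤ _ := by
          simp only [k, q, mul_pow, sobolevWeight_half_sq]
          gcongr
          exact lintegral_kernel_le (by linarith) x
  refine (lintegral_mono key).trans_eq ?_
  rw [lintegral_const_mul' _ _ (kernelBound_lt_top hs).ne,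
    lintegral_lintegral_mul_sub (a := fun y => sobolevWeight (s - 1) y * f y ^ 2)
      (b := fun z => sobolevWeight s z * g z ^ 2) (by fun_prop) (by fun_prop)]

lemma SchwartzMap.fourier_fourier_apply (f : 𝓢(E3, ℂ)) (x : E3) : 𝓕 (𝓕 f) x = f (-x) := by
  have h : 𝓕⁻ (𝓕 f) (-x) = f (-x) := by simp
  rw [← h, fourierInv_apply_eq]
  simp

/-- The Fourier transform of a product is bounded by the convolution of the Fourier transforms. -/
lemma enorm_fourier_mul_le (f g : 𝓢(E3, ℂ)) (x : E3) :
    ‖𝓕 (fun y => f y * g y) x‖ₑ ≤ ∫⁻ y, ‖𝓕 f y‖ₑ * ‖𝓕 g (x - y)‖ₑ := by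
  let B : ℂ →L[ℂ] ℂ →L[ℂ] ℂ := ContinuousLinearMap.mul ℂ ℂ
  have h : pairing B f g = 𝓕 (SchwartzMap.convolution B (𝓕⁻ f) (𝓕⁻ g)) := by
    simp [fourier_convolution]
  have e : 𝓕 (fun y => f y * g y) x = ∫ t, 𝓕⁻ f t * 𝓕⁻ g (-x - t) := by
    calc 𝓕 (fun y => f y * g y) x = 𝓕 (pairing B f g) x := rfl
      _ = _ := by rw [h, SchwartzMap.fourier_fourier_apply, convolution_apply]; rfl
  rw [e, ← integral_neg_eq_self]
  refine (enorm_integral_le_lintegral_enorm _).trans_eq (lintegral_congr fun y => ?_)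
  rw [enorm_mul, fourierInv_apply_eq, fourierInv_apply_eq]
  simp [sub_eq_add_neg, add_comm]

/-- The square of the Sobolev norm, as an extended nonnegative real. -/
def sobolevSq (σ : ℝ) (f : E3 → ℂ) : ENNReal :=
  ∫⁻ x, sobolevWeight σ x * ‖𝓕 f x‖ₑ ^ 2

lemma sobolevSq_mono {σ τ : ℝ} (h : σ ≤ τ) (f : E3 → ℂ) : sobolevSq σ f ≤ sobolevSq τ f := by
  unfold sobolevSq sobolevWeight
  gcongr
  nlinarith [norm_nonneg ‹E3›]

lemma sobolevSq_mul_le {s : ℝ} (hs : 3 / 2 < s) (f g : 𝓢(E3, ℂ)) :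
    sobolevSq (s - 1) (fun x => f x * g x) ≤
      kernelBound s * (sobolevSq (s - 1) f * sobolevSq s g) := by
  refine le_trans ?_ (lintegral_sobolevWeight_mul_convolution_sq_le hs
    (𝓕 f).continuous.enorm.measurable (𝓕 g).continuous.enorm.measurable)
  unfold sobolevSq
  gcongr
  exact enorm_fourier_mul_le f g _

lemma sobolevSq_sub_le (σ : ℝ) (f g : 𝓢(E3, ℂ)) :
    sobolevSq σ (fun x => f x - g x) ≤ 2 * (sobolevSq σ f + sobolevSq σ g) := by
  have hw := measurable_sobolevWeight σ
  have hf := (𝓕 f).continuous.enorm.measurable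
  have hF : 𝓕 (fun x => f x - g x) = fun x => 𝓕 (f : E3 → ℂ) x - 𝓕 (g : E3 → ℂ) x := by
    have : 𝓕 (f - g) = 𝓕 f - 𝓕 g := map_sub (FourierTransform.fourierCLM ℂ 𝓢(E3, ℂ)) f g
    exact congrArg (fun h : 𝓢(E3, ℂ) => (h : E3 → ℂ)) this
  unfold sobolevSq
  rw [hF, ← lintegral_add_left (f := fun x => sobolevWeight σ x * ‖𝓕 (f : E3 → ℂ) x‖ₑ ^ 2)
    (hw.mul (hf.pow_const 2)), ← lintegral_const_mul' _ _ (by simp)]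
  refine lintegral_mono fun x => ?_
  have h2 := pow_le_pow_left' (enorm_sub_le (a := 𝓕 (f : E3 → ℂ) x) (b := 𝓕 (g : E3 → ℂ) x)) 2
  have h3 := ENNReal.rpow_add_le_mul_rpow_add_rpow ‖𝓕 (f : E3 → ℂ) x‖ₑ ‖𝓕 (g : E3 → ℂ) x‖ₑ
    one_le_two
  norm_num at h3
  calc _ ≤ sobolevWeight σ x * (2 * (‖𝓕 (f : E3 → ℂ) x‖ₑ ^ 2 + ‖𝓕 (g : E3 → ℂ) x‖ₑ ^ 2)) := by
        gcongr; exact h2.trans h3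
    _ = _ := by ring

lemma HNorm_sq (σ : ℝ) (f : 𝓢(E3, ℂ)) : HNorm σ f ^ 2 = (sobolevSq σ f).toReal := by
  have hnn : 0 ≤ ∫ ξ : E3, (1 + ‖ξ‖ ^ 2) ^ σ * ‖𝓕 (f : E3 → ℂ) ξ‖ ^ 2 :=
    integral_nonneg fun _ => by positivity
  have hm : Measurable fun ξ : E3 => (1 + ‖ξ‖ ^ 2) ^ σ * ‖𝓕 (f : E3 → ℂ) ξ‖ ^ 2 := by
    have := (𝓕 f).continuous.measurable
    rw [fourier_coe] at this
    fun_prop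
  rw [HNorm, ← Real.sqrt_eq_rpow, Real.sq_sqrt hnn,
    integral_eq_lintegral_of_nonneg_ae (.of_forall fun _ => by positivity)
      hm.aestronglyMeasurable, sobolevSq]
  congr 1
  refine lintegral_congr fun x => ?_
  rw [ENNReal.ofReal_mul (by positivity), ENNReal.ofReal_pow (norm_nonneg _), ofReal_norm,
    sobolevWeight]

lemma sobolevSq_lt_top (σ : ℝ) (f : 𝓢(E3, ℂ)) : sobolevSq σ f < ⊤ := by
  let F : 𝓢(E3, ℂ) := smulLeftCLM ℂ (fun x : E3 => (1 + ‖x‖ ^ 2) ^ (σ / 2)) (𝓕 f)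
  have hF (x : E3) : ‖F x‖ₑ = sobolevWeight (σ / 2) x * ‖𝓕 f x‖ₑ := by
    rw [smulLeftCLM_apply_apply (by fun_prop), enorm_smul, sobolevWeight,
      Real.enorm_of_nonneg (by positivity)]
  have h := (F.memLp 2 volume).eLpNorm_lt_top
  rw [eLpNorm_lt_top_iff_lintegral_rpow_enorm_lt_top (by simp) (by simp)] at h
  simpa [hF, mul_pow, sobolevWeight_half_sq, sobolevSq, fourier_coe] using h

/-- The complexification of a real-valued Schwartz function. -/
def complexify (f : 𝓢(E3, ℝ)) : 𝓢(E3, ℂ) :=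
  f.postcompCLM Complex.ofRealCLM

lemma HNormR_sq (σ : ℝ) (f : 𝓢(E3, ℝ)) :
    HNormR σ f ^ 2 = (sobolevSq σ (complexify f)).toReal :=
  HNorm_sq σ (complexify f)

/-- The pointwise product of two Schwartz functions. -/
def schwartzMul (f g : 𝓢(E3, ℝ)) : 𝓢(E3, ℝ) :=
  pairing (ContinuousLinearMap.mul ℝ ℝ) f g

lemma sobolevSq_schwartzMul_toReal_le {s s' : ℝ} (hs : 3 / 2 < s) (hs' : s - 1 ≤ s')
    (f g : 𝓢(E3, ℝ)) :
    (sobolevSq (s - 1) (complexify (schwartzMul f g))).toReal ≤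
      (kernelBound s).toReal * (HNormR s' f ^ 2 * HNormR s g ^ 2) := by
  rw [HNormR_sq, HNormR_sq, ← ENNReal.toReal_mul, ← ENNReal.toReal_mul]
  refine ENNReal.toReal_mono (ENNReal.mul_lt_top (kernelBound_lt_top hs)
    (ENNReal.mul_lt_top (sobolevSq_lt_top _ _) (sobolevSq_lt_top _ _))).ne ?_
  have e : (complexify (schwartzMul f g) : E3 → ℂ) =
      fun x => complexify f x * complexify g x := by
    ext x
    simp [complexify, schwartzMul]
  rw [e]
  grw [sobolevSq_mul_le hs, sobolevSq_mono hs']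

lemma HNormR_mul_sub_mul_sq_le {s s' : ℝ} (hs : 3 / 2 < s) (hs' : s - 1 ≤ s')
    (f g h k : 𝓢(E3, ℝ)) :
    HNormR (s - 1) (fun x => f x * g x - h x * k x) ^ 2 ≤
      2 * (kernelBound s).toReal *
        (HNormR s' f ^ 2 * HNormR s g ^ 2 + HNormR s' h ^ 2 * HNormR s k ^ 2) := by
  have e : (fun x => f x * g x - h x * k x) = ⇑(schwartzMul f g - schwartzMul h k) := rfl
  have e' : ⇑(complexify (schwartzMul f g - schwartzMul h k)) =
      fun x => complexify (schwartzMul f g) x - complexify (schwartzMul h k) x := by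
    ext x
    simp [complexify]
  rw [e, HNormR_sq, e']
  have hfin (v w : 𝓢(E3, ℝ)) : sobolevSq (s - 1) (complexify (schwartzMul v w)) ≠ ⊤ :=
    (sobolevSq_lt_top _ _).ne
  have h1 := ENNReal.toReal_mono (by finiteness [hfin f g, hfin h k])
    (sobolevSq_sub_le (s - 1) (complexify (schwartzMul f g)) (complexify (schwartzMul h k)))
  rw [ENNReal.toReal_mul, ENNReal.toReal_add (hfin f g) (hfin h k)] at h1
  have h2 := sobolevSq_schwartzMul_toReal_le hs hs' f g
  have h3 := sobolevSq_schwartzMul_toReal_le hs hs' h k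
  simp only [ENNReal.toReal_ofNat] at h1
  linarith

lemma VNorm_nonneg (σ : ℝ) (u : Fin 3 → E3 → ℝ) : 0 ≤ VNorm σ u := by
  unfold VNorm
  positivity

lemma VNorm_sq (σ : ℝ) (u : Fin 3 → E3 → ℝ) :
    VNorm σ u ^ 2 = ∑ i : Fin 3, HNormR σ (u i) ^ 2 := by
  rw [VNorm, ← Real.sqrt_eq_rpow, Real.sq_sqrt (by positivity)]

/-- Lemma 2.7: `∥u × B∥_{H^{s−1}} ≤ C ∥u∥_{H^{s'}} ∥B∥_{H^s}`
for `s > 3/2`, `s−1 ≤ s' ≤ s+1` and Schwartz vector fields `u, B`. -/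
theorem cross_estimate_uB' (s s' : ℝ) (hs : 3 / 2 < s)
    (hs'1 : s - 1 ≤ s') (hs'2 : s' ≤ s + 1) :
    ∃ C : ℝ, 0 < C ∧ ∀ u B : Fin 3 → SchwartzMap E3 ℝ,
      VNorm (s - 1) (crossVF (toVF u) (toVF B)) ≤
        C * VNorm s' (toVF u) * VNorm s (toVF B) := by
  set K := 2 * (kernelBound s).toReal with hK
  have hK0 : 0 ≤ K := by positivity
  refine ⟨√(K + 1), by positivity, fun u B => ?_⟩
  refine le_of_sq_le_sq ?_ (mul_nonneg (mul_nonneg (by positivity) (VNorm_nonneg _ _))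
    (VNorm_nonneg _ _))
  rw [mul_pow, mul_pow, Real.sq_sqrt (by positivity), VNorm_sq, VNorm_sq, VNorm_sq]
  simp only [Fin.sum_univ_three]
  have h0 : HNormR (s - 1) (crossVF (toVF u) (toVF B) 0) ^ 2 ≤ _ :=
    HNormR_mul_sub_mul_sq_le hs hs'1 (u 1) (B 2) (u 2) (B 1)
  have h1 : HNormR (s - 1) (crossVF (toVF u) (toVF B) 1) ^ 2 ≤ _ :=
    HNormR_mul_sub_mul_sq_le hs hs'1 (u 2) (B 0) (u 0) (B 2)
  have h2 : HNormR (s - 1) (crossVF (toVF u) (toVF B) 2) ^ 2 ≤ _ :=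
    HNormR_mul_sub_mul_sq_le hs hs'1 (u 0) (B 1) (u 1) (B 0)
  refine (add_le_add (add_le_add h0 h1) h2).trans ?_
  rw [← hK]
  simp only [toVF]
  have hab (i j : Fin 3) : 0 ≤ HNormR s' (u i) ^ 2 * HNormR s (B j) ^ 2 := by positivity
  have hKab (i : Fin 3) : 0 ≤ K * (HNormR s' (u i) ^ 2 * HNormR s (B i) ^ 2) :=
    mul_nonneg hK0 (hab i i)
  linarith [hab 0 0, hab 0 1, hab 0 2, hab 1 0, hab 1 1, hab 1 2, hab 2 0, hab 2 1, hab 2 2,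
    hKab 0, hKab 1, hKab 2]

end
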